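/- Let M be a symmetric Markov chain on a finite state set S of size m in which every state has holding probability at least 1/2, fix a start state s, and let h_t be the Lovász–Simonovits curve of the t-step distribution from s. Suppose there exist φ ∈ [0,1] and p > 2/m such that for every t′ ≤ t and every k ∈ {1, …, m}, if the level set L_{k,t′} has minimum probability at least p then Φ(L_{k,t′}) ≥ φ. Then for all k ∈ [0, m]: h_t(k) ≤ √k·(1 − φ²/2)^t + p·k. -/

import Mathlib

open scoped Classical

noncomputable section

/-- The permutation ordering the states by decreasing value of `p` (ties broken by the fixed
ordering of indices). -/
def ordPerm {m : ℕ} (p : Fin m → ℝ) : Equiv.Perm (Fin m) :=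
  Tuple.sort fun v => -p v

/-- The level set `L_k`: the first `k` states in decreasing order of `p`. -/
def levelSet {m : ℕ} (p : Fin m → ℝ) (k : ℕ) : Finset (Fin m) :=
  (Finset.univ.filter fun j : Fin m => (j : ℕ) < k).image (ordPerm p)

/-- The Lovász–Simonovits curve of `p`: at integer `k` it equals the sum of the `k` largest
entries of `p`, extended by linear interpolation. -/
def lsCurve {m : ℕ} (p : Fin m → ℝ) (x : ℝ) : ℝ :=
  (∑ j ∈ levelSet p ⌊x⌋₊, p j) +
    (x - (⌊x⌋₊ : ℝ)) * (if h : ⌊x⌋₊ < m then p (ordPerm p ⟨⌊x⌋₊, h⟩) else 0)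

/-- The conductance of a set `T` of states in the chain with transition matrix `M`. -/
def conduct {m : ℕ} (M : Matrix (Fin m) (Fin m) ℝ) (T : Finset (Fin m)) : ℝ :=
  (∑ u ∈ T, ∑ v ∈ Tᶜ, M u v) / min (T.card : ℝ) ((Tᶜ.card : ℝ))

theorem mem_levelSet {m : ℕ} {q : Fin m → ℝ} {k : ℕ} {v : Fin m} :
    v ∈ levelSet q k ↔ (((ordPerm q).symm v : Fin m) : ℕ) < k := by
  simp only [levelSet, Finset.mem_image, Finset.mem_filter, Finset.mem_univ, true_and]
  constructor
  · rintro ⟨j, hj, rfl⟩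
    simpa using hj
  · exact fun h => ⟨_, h, by simp⟩

theorem apply_ordPerm_antitone {m : ℕ} (q : Fin m → ℝ) : Antitone fun j => q (ordPerm q j) := by
  intro i j hij
  have := Tuple.monotone_sort (fun v => -q v) hij
  simpa [ordPerm] using this

theorem levelSet_zero {m : ℕ} (q : Fin m → ℝ) : levelSet q 0 = ∅ := by
  simp [levelSet]

theorem levelSet_succ {m : ℕ} (q : Fin m → ℝ) {k : ℕ} (hk : k < m) :
    levelSet q (k + 1) = insert (ordPerm q ⟨k, hk⟩) (levelSet q k) := by
  ext v
  rw [Finset.mem_insert, mem_levelSet, mem_levelSet, ← Equiv.symm_apply_eq, Fin.ext_iff]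
  simp only
  omega

theorem ordPerm_notMem_levelSet {m : ℕ} (q : Fin m → ℝ) {k : ℕ} (hk : k < m) :
    ordPerm q ⟨k, hk⟩ ∉ levelSet q k := by
  simp [mem_levelSet]

theorem sum_levelSet_succ {m : ℕ} (q f : Fin m → ℝ) {k : ℕ} (hk : k < m) :
    ∑ v ∈ levelSet q (k + 1), f v = f (ordPerm q ⟨k, hk⟩) + ∑ v ∈ levelSet q k, f v := by
  rw [levelSet_succ q hk, Finset.sum_insert (ordPerm_notMem_levelSet q hk)]

theorem card_levelSet {m : ℕ} (q : Fin m → ℝ) {k : ℕ} (hk : k ≤ m) :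
    (levelSet q k).card = k := by
  induction k with
  | zero => simp [levelSet_zero]
  | succ k ih =>
    rw [levelSet_succ q hk, Finset.card_insert_of_notMem (ordPerm_notMem_levelSet q hk),
      ih (by omega)]

/-- Among all weights `0 ≤ c ≤ 1` of given total, the Lovász–Simonovits curve maximizes
`∑ v, c v * q v`. -/
theorem sum_mul_le_lsCurve {m : ℕ} {q c : Fin m → ℝ} (hq : ∀ v, 0 ≤ q v)
    (hc0 : ∀ v, 0 ≤ c v) (hc1 : ∀ v, c v ≤ 1) :
    ∑ v, c v * q v ≤ lsCurve q (∑ v, c v) := by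
  have hxm : ∑ v, c v ≤ m := by
    simpa using Finset.sum_le_sum fun v (_ : v ∈ Finset.univ) => hc1 v
  have hkm : ⌊∑ v, c v⌋₊ ≤ m := Nat.floor_le_of_le hxm
  unfold lsCurve
  set k := ⌊∑ v, c v⌋₊
  set τ : ℝ := if h : k < m then q (ordPerm q ⟨k, h⟩) else 0 with hτ
  have hterm : ∀ v, c v * (q v - τ) ≤ if v ∈ levelSet q k then q v - τ else 0 := by
    intro v
    split_ifs with hv
    · have : τ ≤ q v := by
        rw [hτ]
        split_ifs with h
        · have := apply_ordPerm_antitone q (a := (ordPerm q).symm v) (b := ⟨k, h⟩)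
            (Fin.le_def.2 (mem_levelSet.1 hv).le)
          simpa using this
        · exact hq v
      nlinarith [hc1 v]
    · have hk : k ≤ ((ordPerm q).symm v : ℕ) := by simpa [mem_levelSet] using hv
      have h : k < m := hk.trans_lt (Fin.is_lt _)
      have : q v ≤ τ := by
        rw [hτ, dif_pos h]
        have := apply_ordPerm_antitone q (a := ⟨k, h⟩) (b := (ordPerm q).symm v) (Fin.le_def.2 hk)
        simpa using this
      nlinarith [hc0 v]
  have hsum := Finset.sum_le_sum fun v (_ : v ∈ Finset.univ) => hterm v
  simp only [mul_sub, Finset.sum_sub_distrib, ← Finset.sum_mul, Finset.sum_ite_mem,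
    Finset.univ_inter, Finset.sum_const, nsmul_eq_mul, card_levelSet q hkm] at hsum
  linarith

/-- A concave function dominating the Lovász–Simonovits curve at integers dominates it
everywhere. -/
theorem lsCurve_le_of_concaveOn {m : ℕ} {q : Fin m → ℝ} {F : ℝ → ℝ}
    (hF : ConcaveOn ℝ (Set.Ici 0) F) (hle : ∀ k ≤ m, ∑ v ∈ levelSet q k, q v ≤ F k)
    {x : ℝ} (hx0 : 0 ≤ x) (hxm : x ≤ m) : lsCurve q x ≤ F x := by
  have hfl := Nat.floor_le hx0
  have hlt := (Nat.lt_floor_add_one x).le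
  have hkm : ⌊x⌋₊ ≤ m := Nat.floor_le_of_le hxm
  unfold lsCurve
  set k := ⌊x⌋₊
  split_ifs with h
  · have h₀ := hle k hkm
    have h₁ := hle (k + 1) h
    rw [sum_levelSet_succ q q h, Nat.cast_succ] at h₁
    have hconc := hF.2 (x := (k : ℝ)) (y := (k : ℝ) + 1) (Set.mem_Ici.2 (by positivity))
      (Set.mem_Ici.2 (by positivity)) (sub_nonneg.2 (sub_le_iff_le_add'.2 hlt))
      (sub_nonneg.2 hfl) (by ring)
    simp only [smul_eq_mul] at hconc
    rw [show (1 - (x - k)) * (k : ℝ) + (x - k) * (k + 1) = x by ring] at hconc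
    refine le_trans ?_ hconc
    nlinarith
  · have hk : k = m := by omega
    have hx : x = k := le_antisymm (hk ▸ hxm) hfl
    simpa [hx] using hle k hkm

theorem sqrt_sub_add_sqrt_add_le {φ k : ℝ} (hk : 0 ≤ k) (hφ : 0 ≤ φ) (hφ' : 2 * φ ≤ 1) :
    √(k - 2 * φ * k) + √(k + 2 * φ * k) ≤ 2 * (√k * (1 - φ ^ 2 / 2)) := by
  have h₁ : √(1 - 2 * φ) * √(1 + 2 * φ) ≤ 1 - 2 * φ ^ 2 := by
    rw [← Real.sqrt_mul (by linarith)]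
    exact Real.sqrt_le_iff.2 ⟨by nlinarith, by nlinarith [sq_nonneg (φ ^ 2)]⟩
  have h₂ : √(1 - 2 * φ) + √(1 + 2 * φ) ≤ 2 * (1 - φ ^ 2 / 2) := by
    refine abs_le_of_sq_le_sq' ?_ (by nlinarith) |>.2
    nlinarith [Real.sq_sqrt (show 0 ≤ 1 - 2 * φ by linarith),
      Real.sq_sqrt (show 0 ≤ 1 + 2 * φ by linarith), sq_nonneg (φ ^ 2)]
  rw [show k - 2 * φ * k = k * (1 - 2 * φ) by ring, show k + 2 * φ * k = k * (1 + 2 * φ) by ring,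
    Real.sqrt_mul hk, Real.sqrt_mul hk]
  nlinarith [Real.sqrt_nonneg k]

/-- One step of a lazy symmetric chain: the mass of a set `T` after the step is the average of two
weighted masses before it, whose weights have totals `|T|` minus and plus `2 a`, for any `a`
between `0` and the boundary flow of `T`. -/
theorem sum_step_le_lsCurve {m : ℕ} {M : Matrix (Fin m) (Fin m) ℝ}
    (hsymm : ∀ u v, M u v = M v u) (hnonneg : ∀ u v, 0 ≤ M u v)
    (hrow : ∀ u, ∑ v, M u v = 1) (hlazy : ∀ u, (1 : ℝ) / 2 ≤ M u u)
    {q : Fin m → ℝ} (hq : ∀ v, 0 ≤ q v) (T : Finset (Fin m)) {a : ℝ} (ha : 0 ≤ a)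
    (ha' : a ≤ ∑ u ∈ T, ∑ v ∈ Tᶜ, M u v) :
    ∑ v ∈ T, ∑ u, q u * M u v ≤
      (lsCurve q (T.card - 2 * a) + lsCurve q (T.card + 2 * a)) / 2 := by
  set b := ∑ u ∈ T, ∑ v ∈ Tᶜ, M u v with hb
  set g : Fin m → ℝ := fun u => ∑ v ∈ T, M u v with hg
  set d : Fin m → ℝ := fun u => if u ∈ T then 1 - g u else g u with hd
  have hcompl : ∀ u, g u + ∑ v ∈ Tᶜ, M u v = 1 := fun u => by
    rw [hg, ← hrow u]; exact Finset.sum_add_sum_compl T _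
  have hg0 : ∀ u, 0 ≤ g u := fun u => Finset.sum_nonneg fun v _ => hnonneg u v
  have hd0 : ∀ u, 0 ≤ d u := by
    intro u
    have := hcompl u
    have h' : 0 ≤ ∑ v ∈ Tᶜ, M u v := Finset.sum_nonneg fun v _ => hnonneg u v
    simp only [hd]
    split_ifs <;> linarith [hg0 u]
  have hdg : ∀ u, 0 ≤ g u - d u ∧ g u + d u ≤ 1 := by
    intro u
    have := hcompl u
    simp only [hd]
    split_ifs with hu
    · have : M u u ≤ g u := Finset.single_le_sum (fun v _ => hnonneg u v) hu
      constructor <;> linarith [hlazy u]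
    · have : M u u ≤ ∑ v ∈ Tᶜ, M u v :=
        Finset.single_le_sum (fun v _ => hnonneg u v) (Finset.mem_compl.2 hu)
      constructor <;> linarith [hlazy u]
  have hgsum : ∑ u, g u = T.card := by
    have : ∀ v ∈ T, ∑ u, M u v = 1 := fun v _ => by
      rw [← hrow v]; exact Finset.sum_congr rfl fun u _ => hsymm u v
    refine Finset.sum_comm.trans ((Finset.sum_congr rfl this).trans ?_)
    simp
  have hdT : ∑ u ∈ T, d u = b := Finset.sum_congr rfl fun u hu => by
    simp only [hd, if_pos hu]; linarith [hcompl u]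
  have hdTc : ∑ u ∈ Tᶜ, d u = b := by
    refine Eq.trans (Finset.sum_congr rfl fun u hu => ?_) Finset.sum_comm
    simp only [hd, if_neg (Finset.mem_compl.1 hu), hg]
    exact Finset.sum_congr rfl fun v _ => hsymm u v
  have hdsum : ∑ u, d u = 2 * b := by
    rw [← Finset.sum_add_sum_compl T, hdT, hdTc]; ring
  obtain ⟨r, hr0, hr1, hrb⟩ : ∃ r : ℝ, 0 ≤ r ∧ r ≤ 1 ∧ r * b = a := by
    rcases (ha.trans ha').eq_or_lt with h | h
    · exact ⟨0, le_rfl, zero_le_one, by linarith⟩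
    · exact ⟨a / b, div_nonneg ha h.le, (div_le_one h).2 ha', div_mul_cancel₀ _ h.ne'⟩
  have hrd : ∀ u, 0 ≤ r * d u ∧ r * d u ≤ d u := fun u =>
    ⟨mul_nonneg hr0 (hd0 u), mul_le_of_le_one_left (hd0 u) hr1⟩
  have hminus := sum_mul_le_lsCurve hq (c := fun u => g u - r * d u)
    (fun u => by linarith [(hrd u).2, (hdg u).1])
    (fun u => by linarith [(hrd u).1, (hdg u).2, hd0 u])
  have hplus := sum_mul_le_lsCurve hq (c := fun u => g u + r * d u)
    (fun u => by linarith [(hrd u).1, hg0 u])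
    (fun u => by linarith [(hrd u).2, (hdg u).2])
  rw [Finset.sum_sub_distrib, ← Finset.mul_sum, hgsum, hdsum,
    show (T.card : ℝ) - r * (2 * b) = T.card - 2 * a by rw [← hrb]; ring] at hminus
  rw [Finset.sum_add_distrib, ← Finset.mul_sum, hgsum, hdsum,
    show (T.card : ℝ) + r * (2 * b) = T.card + 2 * a by rw [← hrb]; ring] at hplus
  have hmass : ∑ v ∈ T, ∑ u, q u * M u v = ∑ u, g u * q u := by
    rw [Finset.sum_comm]
    exact Finset.sum_congr rfl fun u _ => by rw [← Finset.mul_sum, mul_comm]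
  have havg : ∑ u, (g u - r * d u) * q u + ∑ u, (g u + r * d u) * q u = 2 * ∑ u, g u * q u := by
    rw [← Finset.sum_add_distrib, Finset.mul_sum]
    exact Finset.sum_congr rfl fun u _ => by ring
  linarith

theorem boundary_flow_le_half_card {m : ℕ} {M : Matrix (Fin m) (Fin m) ℝ}
    (hnonneg : ∀ u v, 0 ≤ M u v) (hrow : ∀ u, ∑ v, M u v = 1)
    (hlazy : ∀ u, (1 : ℝ) / 2 ≤ M u u) (T : Finset (Fin m)) :
    ∑ u ∈ T, ∑ v ∈ Tᶜ, M u v ≤ T.card / 2 := by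
  have : ∀ u ∈ T, ∑ v ∈ Tᶜ, M u v ≤ 1 / 2 := by
    intro u hu
    have h₁ := Finset.sum_add_sum_compl T fun v => M u v
    have h₂ : M u u ≤ ∑ v ∈ T, M u v := Finset.single_le_sum (fun v _ => hnonneg u v) hu
    linarith [hlazy u, hrow u]
  refine (Finset.sum_le_sum this).trans_eq ?_
  simp [div_eq_mul_inv]

theorem concaveOn_sqrt_mul_add_mul {c : ℝ} (hc : 0 ≤ c) (p : ℝ) :
    ConcaveOn ℝ (Set.Ici 0) fun x => √x * c + p * x := by
  refine ⟨convex_Ici 0, fun x hx y hy a b ha hb hab => ?_⟩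
  have := mul_le_mul_of_nonneg_right
    (Real.strictConcaveOn_sqrt.concaveOn.2 hx hy ha hb hab) hc
  simp only [smul_eq_mul] at this ⊢
  linarith

theorem pow_row_sum_eq_one {m : ℕ} {M : Matrix (Fin m) (Fin m) ℝ}
    (hrow : ∀ u, ∑ v, M u v = 1) (t : ℕ) (s : Fin m) : ∑ v, (M ^ t) s v = 1 := by
  induction t with
  | zero => simp [Matrix.one_apply]
  | succ t ih =>
    simp only [pow_succ, Matrix.mul_apply]
    rw [Finset.sum_comm]
    simp [← Finset.mul_sum, hrow, ih]

theorem pow_apply_nonneg {m : ℕ} {M : Matrix (Fin m) (Fin m) ℝ}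
    (hnonneg : ∀ u v, 0 ≤ M u v) (t : ℕ) (s v : Fin m) : 0 ≤ (M ^ t) s v := by
  induction t generalizing v with
  | zero => rw [pow_zero, Matrix.one_apply]; split_ifs <;> norm_num
  | succ t ih =>
    rw [pow_succ, Matrix.mul_apply]
    exact Finset.sum_nonneg fun u _ => mul_nonneg (ih u) (hnonneg u v)

/-- A level set whose minimum probability exceeds `2 / m` has fewer than `m / 2` elements. -/
theorem two_mul_lt_of_le_apply_ordPerm {m : ℕ} {q : Fin m → ℝ} (hq : ∀ v, 0 ≤ q v)
    (hsum : ∑ v, q v = 1) {p : ℝ} (hp : 2 / (m : ℝ) < p) {k : ℕ} (hk : k < m)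
    (hpk : p ≤ q (ordPerm q ⟨k, hk⟩)) : 2 * (k + 1) < m := by
  have hm : (0 : ℝ) < m := Nat.cast_pos.2 (by omega)
  have h₁ : ((k + 1 : ℕ) : ℝ) * p ≤ 1 := by
    rw [← hsum, ← card_levelSet q (k := k + 1) hk, ← nsmul_eq_mul]
    refine (Finset.card_nsmul_le_sum _ q p fun v hv => hpk.trans ?_).trans
      (Finset.sum_le_sum_of_subset_of_nonneg (Finset.subset_univ _) fun v _ _ => hq v)
    have := apply_ordPerm_antitone q (a := (ordPerm q).symm v) (b := ⟨k, hk⟩)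
      (Fin.le_def.2 (Nat.lt_succ_iff.1 (mem_levelSet.1 hv)))
    simpa using this
  rw [div_lt_iff₀ hm] at hp
  have h₂ : (2 * (k + 1 : ℕ) : ℝ) < m := by
    have : (0 : ℝ) < (k + 1 : ℕ) := by positivity
    nlinarith
  exact_mod_cast h₂

/-- if every level set of minimum probability at least `p` has conductance at
least `φ` (at all times `t' ≤ t`), then the Lovász–Simonovits curve at time `t` satisfies
`h_t(x) ≤ √x (1 - φ²/2)^t + p x` on `[0, m]`. -/
theorem ls_curve_decay (m : ℕ) (M : Matrix (Fin m) (Fin m) ℝ)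
    (hsymm : ∀ u v, M u v = M v u) (hnonneg : ∀ u v, 0 ≤ M u v)
    (hrow : ∀ u, ∑ v, M u v = 1) (hlazy : ∀ u, (1 : ℝ) / 2 ≤ M u u)
    (s : Fin m) (t : ℕ) (φ p : ℝ) (hφ0 : 0 ≤ φ) (hφ1 : φ ≤ 1) (hp : 2 / (m : ℝ) < p)
    (hcond : ∀ t', t' ≤ t → ∀ k : ℕ, ∀ hk1 : 1 ≤ k, ∀ hkm : k ≤ m,
      p ≤ (M ^ t') s (ordPerm (fun v => (M ^ t') s v) ⟨k - 1, by omega⟩) →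
      φ ≤ conduct M (levelSet (fun v => (M ^ t') s v) k)) :
    ∀ x : ℝ, 0 ≤ x → x ≤ m →
      lsCurve (fun v => (M ^ t) s v) x ≤ Real.sqrt x * (1 - φ ^ 2 / 2) ^ t + p * x := by
  have hr : 0 ≤ 1 - φ ^ 2 / 2 := by nlinarith
  have hp0 : 0 ≤ p := (by positivity : (0 : ℝ) ≤ 2 / m).trans hp.le
  induction t with
  | zero =>
    refine fun x => lsCurve_le_of_concaveOn (concaveOn_sqrt_mul_add_mul (pow_nonneg hr 0) p) ?_
    intro k _
    rcases Nat.eq_zero_or_pos k with rfl | hk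
    · simp [levelSet_zero]
    · have h₁ : ∑ v ∈ levelSet (fun v => (M ^ 0) s v) k, (M ^ 0) s v ≤ 1 :=
        pow_row_sum_eq_one hrow 0 s ▸ Finset.sum_le_sum_of_subset_of_nonneg (Finset.subset_univ _)
          fun v _ _ => pow_apply_nonneg hnonneg 0 s v
      have h₂ : 1 ≤ √(k : ℝ) := Real.one_le_sqrt.2 (by exact_mod_cast hk)
      have h₃ : 0 ≤ p * k := by positivity
      simpa using h₁.trans (by linarith)
  | succ t ih =>
    specialize ih fun t' ht' => hcond t' (by omega)
    refine fun x => lsCurve_le_of_concaveOn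
      (concaveOn_sqrt_mul_add_mul (pow_nonneg hr (t + 1)) p) ?_
    intro k
    induction k with
    | zero => simp [levelSet_zero]
    | succ k ihk =>
      intro hk
      set q : Fin m → ℝ := fun v => (M ^ (t + 1)) s v with hq
      by_cases hpk : p ≤ q (ordPerm q ⟨k, hk⟩)
      · have hΦ : φ ≤ conduct M (levelSet q (k + 1)) := hcond (t + 1) le_rfl (k + 1) (by omega) hk hpk
        have hkm := two_mul_lt_of_le_apply_ordPerm (fun v => pow_apply_nonneg hnonneg _ s v)
          (pow_row_sum_eq_one hrow (t + 1) s) hp hk hpk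
        have hcard : (levelSet q (k + 1)).card = k + 1 := card_levelSet q hk
        have hkm' : 2 * ((k + 1 : ℕ) : ℝ) ≤ m := by exact_mod_cast hkm.le
        have hk0 : (0 : ℝ) < (k + 1 : ℕ) := by positivity
        have hmin : ((k + 1 : ℕ) : ℝ) ≤ ((m - (k + 1) : ℕ) : ℝ) := by
          exact_mod_cast (by omega : k + 1 ≤ m - (k + 1))
        rw [conduct, Finset.card_compl, hcard, Fintype.card_fin, min_eq_left hmin,
          le_div_iff₀ hk0] at hΦ
        have hflow := boundary_flow_le_half_card hnonneg hrow hlazy (levelSet q (k + 1))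
        rw [hcard] at hflow
        have hstep := sum_step_le_lsCurve hsymm hnonneg hrow hlazy
          (q := fun v => (M ^ t) s v) (fun v => pow_apply_nonneg hnonneg t s v)
          (levelSet q (k + 1)) (mul_nonneg hφ0 hk0.le) hΦ
        rw [hcard] at hstep
        have hmass : ∑ v ∈ levelSet q (k + 1), q v =
            ∑ v ∈ levelSet q (k + 1), ∑ u, (M ^ t) s u * M u v := by
          simp only [hq, pow_succ, Matrix.mul_apply]
        rw [hmass]
        clear_value q
        generalize ((k + 1 : ℕ) : ℝ) = κ at *
        have hφ2 : 2 * φ ≤ 1 := by nlinarith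
        have h₁ := ih (κ - 2 * (φ * κ)) (by nlinarith) (by nlinarith)
        have h₂ := ih (κ + 2 * (φ * κ)) (by nlinarith) (by nlinarith)
        have h₃ := mul_le_mul_of_nonneg_right (sqrt_sub_add_sqrt_add_le hk0.le hφ0 hφ2)
          (pow_nonneg hr t)
        rw [← mul_assoc] at h₁ h₂ hstep
        rw [pow_succ]
        linarith
      · rw [sum_levelSet_succ q q hk]
        have h₁ := ihk (by omega)
        have h₂ : √(k : ℝ) ≤ √((k + 1 : ℕ) : ℝ) := Real.sqrt_le_sqrt (by simp)
        have h₃ := mul_le_mul_of_nonneg_right h₂ (pow_nonneg hr (t + 1))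
        push_cast at h₃ ⊢
        linarith
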